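/- Consider a two-player game with finite nonempty action sets A¹ and A² and reward function r¹ : A¹ × A² → ℝ for player 1, with expected reward r¹(a¹, σ²) = Σ_{a²∈A²} r¹(a¹, a²)·σ²(a²) for a mixed strategy σ² on A². Let σ² be a mixed strategy on A², let ā² ∈ A², and let a¹ ∈ A¹ be such that (i) r¹(a¹, σ²) ≥ r¹(b, σ²) for every b ∈ A¹, and (ii) r¹(a¹, ā²) > r¹(b, ā²) for every b ∈ A¹ with b ≠ a¹. Then for every λ with 0 < λ ≤ 1, the action a¹ is the unique maximizer of b ↦ r¹(b, (1 − λ)·σ² + λ·δ_{ā²}); i.e., after the fictitious-play estimate update toward the observed action ā², the best response of player 1 is still a¹. Consequently, if the players' joint action is a strict Nash equilibrium and each player's current best response to its estimate is its equilibrium action, then the same joint action is played at every subsequent iteration of fictitious play. -/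

import Mathlib

open Finset

theorem fp_update_aux {A B : Type*} [Fintype B] [DecidableEq B] (r : A → B → ℝ)
    (σ : B → ℝ) (abar : B) (a : A)
    (h : ∀ b : A, (∑ x : B, r b x * σ x) ≤ ∑ x : B, r a x * σ x)
    (hs : ∀ b : A, b ≠ a → r b abar < r a abar)
    (lam : ℝ) (h0 : 0 < lam) (h1 : lam ≤ 1) (b : A) (hb : b ≠ a) :
    (∑ x : B, r b x * ((1 - lam) * σ x + lam * (if x = abar then 1 else 0)))
      < ∑ x : B, r a x * ((1 - lam) * σ x + lam * (if x = abar then 1 else 0)) := by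
  have key : ∀ c : A, (∑ x : B, r c x * ((1 - lam) * σ x + lam * (if x = abar then 1 else 0)))
      = (1 - lam) * (∑ x : B, r c x * σ x) + lam * r c abar := by
    intro c
    have e : lam * r c abar = ∑ x : B, r c x * (lam * (if x = abar then 1 else 0)) := by
      simp [mul_comm]
    rw [e, Finset.mul_sum, ← Finset.sum_add_distrib]
    exact Finset.sum_congr rfl fun x _ => by ring
  rw [key, key]
  have e1 := mul_le_mul_of_nonneg_left (h b) (sub_nonneg.2 h1)
  have e2 := mul_lt_mul_of_pos_left (hs b hb) h0
  linarith

/-- (i) If `a¹` is a best response to the current estimate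
`σ²` and the strictly unique best response to the observed action `ā²`, then
after the fictitious-play update `σ²' = (1-λ)σ² + λδ_{ā²}` (with `0 < λ ≤ 1`)
the action `a¹` is the unique maximizer of the expected reward.
(ii) Consequently, if the joint action `(a¹*, a²*)` is a strict Nash
equilibrium and each player's current best response to its estimate is its
equilibrium action, then in fictitious play (players repeatedly play a best
response to their estimate and update estimates toward the observed action)
the same joint action is played at every subsequent iteration. -/
theorem strict_nash_absorbing_for_fictitious_play
    {A1 A2 : Type*} [Fintype A1] [Fintype A2] [Nonempty A1] [Nonempty A2]
    [DecidableEq A1] [DecidableEq A2]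
    (r1 r2 : A1 → A2 → ℝ) :
    -- (i) unique best response is preserved by the estimate update
    (∀ σ2 : A2 → ℝ, (∀ a : A2, 0 ≤ σ2 a) → (∑ a : A2, σ2 a) = 1 →
      ∀ (abar : A2) (a1 : A1),
        (∀ b : A1, (∑ a2 : A2, r1 b a2 * σ2 a2) ≤ ∑ a2 : A2, r1 a1 a2 * σ2 a2) →
        (∀ b : A1, b ≠ a1 → r1 b abar < r1 a1 abar) →
        ∀ lam : ℝ, 0 < lam → lam ≤ 1 →
          ∀ b : A1, b ≠ a1 →
            (∑ a2 : A2, r1 b a2 * ((1 - lam) * σ2 a2 + lam * (if a2 = abar then 1 else 0)))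
              < ∑ a2 : A2, r1 a1 a2 * ((1 - lam) * σ2 a2 + lam * (if a2 = abar then 1 else 0))) ∧
    -- (ii) a strict Nash equilibrium, once played as best response, is played forever
    (∀ (a1star : A1) (a2star : A2),
      (∀ b : A1, b ≠ a1star → r1 b a2star < r1 a1star a2star) →
      (∀ c : A2, c ≠ a2star → r2 a1star c < r2 a1star a2star) →
      ∀ (σ1est : ℕ → A1 → ℝ) (σ2est : ℕ → A2 → ℝ) (lam : ℕ → ℝ)
        (p1 : ℕ → A1) (p2 : ℕ → A2),
        (∀ (t : ℕ) (a : A1), 0 ≤ σ1est t a) → (∀ t : ℕ, (∑ a : A1, σ1est t a) = 1) →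
        (∀ (t : ℕ) (a : A2), 0 ≤ σ2est t a) → (∀ t : ℕ, (∑ a : A2, σ2est t a) = 1) →
        (∀ t : ℕ, 0 < lam t ∧ lam t ≤ 1) →
        -- each player updates its estimate toward the opponent's observed action
        (∀ (t : ℕ) (a : A2),
          σ2est (t + 1) a = (1 - lam t) * σ2est t a + lam t * (if a = p2 t then 1 else 0)) →
        (∀ (t : ℕ) (a : A1),
          σ1est (t + 1) a = (1 - lam t) * σ1est t a + lam t * (if a = p1 t then 1 else 0)) →
        -- each player plays a best response to its current estimate
        (∀ (t : ℕ) (b : A1),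
          (∑ a2 : A2, r1 b a2 * σ2est t a2) ≤ ∑ a2 : A2, r1 (p1 t) a2 * σ2est t a2) →
        (∀ (t : ℕ) (c : A2),
          (∑ a1 : A1, σ1est t a1 * r2 a1 c) ≤ ∑ a1 : A1, σ1est t a1 * r2 a1 (p2 t)) →
        -- the current best responses are the equilibrium actions
        p1 0 = a1star → p2 0 = a2star →
        ∀ t : ℕ, p1 t = a1star ∧ p2 t = a2star) := by
  refine ⟨fun σ _ _ abar a h hs lam h0 h1 b hb =>
    fp_update_aux r1 σ abar a h hs lam h0 h1 b hb, ?_⟩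
  intro a1 a2 hs1 hs2 s1 s2 lam p1 p2 _ _ _ _ hl u2 u1 b1 b2 i1 i2 t
  induction t with
  | zero => exact ⟨i1, i2⟩
  | succ t ih =>
    obtain ⟨q1, q2⟩ := ih
    constructor
    · by_contra hne
      have h := fp_update_aux r1 (s2 t) a2 a1 (fun b => q1 ▸ b1 t b) hs1 (lam t)
        (hl t).1 (hl t).2 _ hne
      have h' := b1 (t + 1) a1
      simp only [u2, q2] at h'
      exact absurd h (not_lt.2 h')
    · by_contra hne
      have hb : ∀ c : A2, (∑ x : A1, r2 x c * s1 t x) ≤ ∑ x : A1, r2 x a2 * s1 t x := by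
        intro c
        have := b2 t c
        rw [q2] at this
        simpa only [mul_comm] using this
      have h := fp_update_aux (fun c x => r2 x c) (s1 t) a1 a2 hb hs2 (lam t)
        (hl t).1 (hl t).2 _ hne
      have h' := b2 (t + 1) a2
      simp only [mul_comm (s1 (t + 1) _)] at h'
      simp only [u1, q1] at h'
      exact absurd h (not_lt.2 h')
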